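/- Assume condition (C). Let Q be of form (Q2) and suppose that for each n ∈ {1,…,N} the two vectors u^{(n)} = (Q(ξ_n^{(h)}))_{h=0}^{2s_n} and v^{(n)} = ((−1)^h Q(ξ_n^{(h)}+iπ))_{h=0}^{2s_n} in ℂ^{2s_n+1} are linearly dependent and not both zero. Then Q satisfies the Wronskian relation with some ε ∈ {−1, +1}, there exists a function t of t-form with t(λ)·w_ε(λ) = Q(λ+η)Q(λ+iπ−η) − Q(λ+η+iπ)Q(λ−η) for all λ ∈ ℂ, and this t satisfies det D_t^{(n)} = 0 for every n = 1,…,N. -/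

import Mathlib

open Complex Finset

noncomputable section

/-- Shifted inhomogeneity parameter `ξ_n^{(k)} = ξ_n + (s_n − k) η`, where `σ n = 2 s_n`. -/
def xik {N : ℕ} (η : ℂ) (σ : Fin N → ℕ) (ξ : Fin N → ℂ) (n : Fin N) (k : ℕ) : ℂ :=
  ξ n + ((σ n : ℂ) / 2 - (k : ℂ)) * η

/-- `a(λ) = ∏ₙ sinh (λ − ξ_n + s_n η)`. -/
def afun {N : ℕ} (η : ℂ) (σ : Fin N → ℕ) (ξ : Fin N → ℂ) (lam : ℂ) : ℂ :=
  ∏ n, Complex.sinh (lam - ξ n + ((σ n : ℂ) / 2) * η)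

/-- `d(λ) = ∏ₙ sinh (λ − ξ_n − s_n η)`. -/
def dfun {N : ℕ} (η : ℂ) (σ : Fin N → ℕ) (ξ : Fin N → ℂ) (lam : ℂ) : ℂ :=
  ∏ n, Complex.sinh (lam - ξ n - ((σ n : ℂ) / 2) * η)

/-- `t` is of t-form: `t(λ) = e^{−(N−1)λ} ∑_{j=0}^{N−1} c_j e^{2jλ}`. -/
def tForm (N : ℕ) (t : ℂ → ℂ) : Prop :=
  ∃ c : Fin N → ℂ, ∀ lam : ℂ,
    t lam = Complex.exp (-((N : ℂ) - 1) * lam) * ∑ j, c j * Complex.exp (2 * ((j : ℕ) : ℂ) * lam)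

/-- The `(2s_n+1) × (2s_n+1)` tridiagonal matrix `D_t^{(n)}`. -/
def Dmat {N : ℕ} (η : ℂ) (σ : Fin N → ℕ) (ξ : Fin N → ℂ) (t : ℂ → ℂ) (n : Fin N) :
    Matrix (Fin (σ n + 1)) (Fin (σ n + 1)) ℂ :=
  Matrix.of fun h k =>
    if (h : ℕ) = (k : ℕ) then t (xik η σ ξ n (h : ℕ))
    else if (k : ℕ) = (h : ℕ) + 1 then afun η σ ξ (xik η σ ξ n (h : ℕ))
    else if (h : ℕ) = (k : ℕ) + 1 then -(dfun η σ ξ (xik η σ ξ n (h : ℕ)))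
    else 0

/-- The set `Ξ_i = {ξ_i + kη + k′ iπ : k ∈ {−s_i, …, s_i}, k′ ∈ ℤ}`. -/
def XiSet {N : ℕ} (η : ℂ) (σ : Fin N → ℕ) (ξ : Fin N → ℂ) (i : Fin N) : Set ℂ :=
  {z : ℂ | ∃ k : ℕ, k ≤ σ i ∧ ∃ k' : ℤ, z = xik η σ ξ i k + (k' : ℂ) * ((Real.pi : ℂ) * Complex.I)}

/-- Condition (C): the sets `Ξ_i` are pairwise disjoint. -/
def CondC {N : ℕ} (η : ℂ) (σ : Fin N → ℕ) (ξ : Fin N → ℂ) : Prop :=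
  ∀ i j : Fin N, i ≠ j → XiSet η σ ξ i ∩ XiSet η σ ξ j = ∅

/-- The inhomogeneous term `F_x(λ)`. -/
def Ffun {N : ℕ} (η : ℂ) (σ : Fin N → ℕ) (ξ : Fin N → ℂ) (x lam : ℂ) : ℂ :=
  2 * Complex.exp (-(((∑ n, σ n : ℕ) : ℂ) + 1) * η / 2) *
    Complex.sinh (lam - x + (∑ j, ∑ h ∈ Finset.Icc 1 (σ j), xik η σ ξ j h)
      + (((∑ n, σ n : ℕ) : ℂ) + 1) * η / 2) *
    ∏ j, ∏ h ∈ Finset.range (σ j + 1), Complex.sinh (lam - xik η σ ξ j h)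

/-- `w_ε(λ) = 2 ε (i/2)^{N_s} ∏ₙ ∏_{h=1}^{2s_n−1} sinh(λ − ξ_n^{(h)})`. -/
def wfun {N : ℕ} (η : ℂ) (σ : Fin N → ℕ) (ξ : Fin N → ℂ) (ε lam : ℂ) : ℂ :=
  2 * ε * (Complex.I / 2) ^ (∑ n, σ n) *
    ∏ n, ∏ h ∈ Finset.Icc 1 (σ n - 1), Complex.sinh (lam - xik η σ ξ n h)

/-- Trigonometric polynomials of degree `m` in `exp (2 λ)`. -/
def IsTrigPoly (m : ℕ) (f : ℂ → ℂ) : Prop :=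
  ∃ p : Polynomial ℂ, p.natDegree ≤ m ∧
    ∀ lam : ℂ, f lam = exp (-(m : ℂ) * lam) * p.eval (exp (2 * lam))

/-- Trigonometric polynomials of degree `m` in `exp λ`. -/
def IsHalfTrigPoly (m : ℕ) (f : ℂ → ℂ) : Prop :=
  ∃ p : Polynomial ℂ, p.natDegree ≤ m ∧
    ∀ lam : ℂ, f lam = exp (-(m : ℂ) * (lam / 2)) * p.eval (exp lam)

lemma IsHalfTrigPoly.mul {m k : ℕ} {f g : ℂ → ℂ} (hf : IsHalfTrigPoly m f)
    (hg : IsHalfTrigPoly k g) : IsHalfTrigPoly (m + k) (fun lam => f lam * g lam) := by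
  obtain ⟨p, hp, hfp⟩ := hf
  obtain ⟨q, hq, hgq⟩ := hg
  refine ⟨p * q, Polynomial.natDegree_mul_le.trans (add_le_add hp hq), fun lam => ?_⟩
  have : exp (-((m + k : ℕ) : ℂ) * (lam / 2))
      = exp (-(m : ℂ) * (lam / 2)) * exp (-(k : ℂ) * (lam / 2)) := by
    rw [← exp_add]; congr 1; push_cast; ring
  simp only [hfp, hgq, this, Polynomial.eval_mul]
  ring

lemma IsHalfTrigPoly.add {m : ℕ} {f g : ℂ → ℂ} (hf : IsHalfTrigPoly m f)
    (hg : IsHalfTrigPoly m g) : IsHalfTrigPoly m (fun lam => f lam + g lam) := by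
  obtain ⟨p, hp, hfp⟩ := hf
  obtain ⟨q, hq, hgq⟩ := hg
  refine ⟨p + q, Polynomial.natDegree_add_le_of_degree_le hp hq, fun lam => ?_⟩
  simp only [hfp, hgq, Polynomial.eval_add]
  ring

lemma IsHalfTrigPoly.sub {m : ℕ} {f g : ℂ → ℂ} (hf : IsHalfTrigPoly m f)
    (hg : IsHalfTrigPoly m g) : IsHalfTrigPoly m (fun lam => f lam - g lam) := by
  obtain ⟨p, hp, hfp⟩ := hf
  obtain ⟨q, hq, hgq⟩ := hg
  refine ⟨p - q, Polynomial.natDegree_sub_le_of_le hp hq |>.trans (max_self m).le, fun lam => ?_⟩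
  simp only [hfp, hgq, Polynomial.eval_sub]
  ring

lemma isHalfTrigPoly_prod_sinh {m : ℕ} (ν : Fin m → ℂ) (c : ℂ) :
    IsHalfTrigPoly m (fun lam => ∏ j, sinh ((lam + c - ν j) / 2)) := by
  refine ⟨∏ j, (Polynomial.C (exp ((c - ν j) / 2) / 2) * Polynomial.X
    + Polynomial.C (-exp (-((c - ν j) / 2)) / 2)), ?_, fun lam => ?_⟩
  · refine (Polynomial.natDegree_prod_le _ _).trans
      ((Finset.sum_le_sum fun j _ => Polynomial.natDegree_linear_le).trans ?_)
    simp
  · have hm : exp (-(m : ℂ) * (lam / 2)) = ∏ _j : Fin m, exp (-(lam / 2)) := by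
      rw [Finset.prod_const, Finset.card_univ, Fintype.card_fin, ← exp_nat_mul]
      congr 1; ring
    rw [hm, Polynomial.eval_prod, ← Finset.prod_mul_distrib]
    refine Finset.prod_congr rfl fun j _ => ?_
    have h1 : exp ((lam + c - ν j) / 2) = exp (-(lam / 2)) * exp lam * exp ((c - ν j) / 2) := by
      rw [← exp_add, ← exp_add]; congr 1; ring
    have h2 : exp (-((lam + c - ν j) / 2)) = exp (-(lam / 2)) * exp (-((c - ν j) / 2)) := by
      rw [← exp_add]; congr 1; ring
    simp only [Complex.sinh, h1, h2, Polynomial.eval_add, Polynomial.eval_mul, Polynomial.eval_C,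
      Polynomial.eval_X]
    ring

lemma coeff_comp_neg_X (p : Polynomial ℂ) (n : ℕ) :
    (p.comp (-Polynomial.X)).coeff n = (-1) ^ n * p.coeff n := by
  rw [← mul_comm (p.coeff n), ← Polynomial.comp_C_mul_X_coeff]
  simp

lemma exists_expand_two_of_comp_neg_X {p : Polynomial ℂ} (h : p.comp (-Polynomial.X) = p) :
    ∃ r : Polynomial ℂ, p = Polynomial.expand ℂ 2 r := by
  refine ⟨Polynomial.contract 2 p, ?_⟩
  ext n
  rw [Polynomial.coeff_expand two_pos]
  split_ifs with hn
  · rw [Polynomial.coeff_contract two_ne_zero, Nat.div_mul_cancel hn]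
  · have h1 := congrArg (fun q => Polynomial.coeff q n) h
    simp only [coeff_comp_neg_X] at h1
    rw [(Nat.not_even_iff_odd.1 fun h => hn h.two_dvd).neg_one_pow] at h1
    linear_combination (-1 / 2 : ℂ) * h1

lemma comp_neg_X_eq {m : ℕ} {f : ℂ → ℂ} {p : Polynomial ℂ} {κ : ℂ}
    (hf : ∀ lam : ℂ, f lam = exp (-((2 * m : ℕ) : ℂ) * (lam / 2)) * p.eval (exp lam))
    (hper : ∀ lam, f (lam + (Real.pi : ℂ) * I) = κ * (-1) ^ m * f lam) :
    p.comp (-Polynomial.X) = Polynomial.C κ * p := by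
  have key : Polynomial.X * p.comp (-Polynomial.X) = Polynomial.X * (Polynomial.C κ * p) := by
    refine Polynomial.funext fun x => ?_
    simp only [Polynomial.eval_mul, Polynomial.eval_X, Polynomial.eval_comp, Polynomial.eval_neg,
      Polynomial.eval_C]
    by_cases hx : x = 0
    · simp [hx]
    have h := hper (log x)
    have he : exp (-((2 * m : ℕ) : ℂ) * ((log x + (Real.pi : ℂ) * I) / 2))
        = exp (-((2 * m : ℕ) : ℂ) * (log x / 2)) * (-1) ^ m := by
      have : ((-1 : ℂ)) ^ m = exp ((m : ℂ) * (-((Real.pi : ℂ) * I))) := by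
        rw [exp_nat_mul, exp_neg, exp_pi_mul_I]; norm_num
      rw [this, ← exp_add]; congr 1; push_cast; ring
    rw [hf, hf, he, exp_add, exp_pi_mul_I, exp_log hx] at h
    have hne : exp (-((2 * m : ℕ) : ℂ) * (log x / 2)) * (-1) ^ m ≠ 0 :=
      mul_ne_zero (exp_ne_zero _) (pow_ne_zero _ (by norm_num))
    have h2 : Polynomial.eval (-x) p = κ * Polynomial.eval x p := by
      apply mul_left_cancel₀ hne
      rw [← neg_one_mul x, mul_comm (-1) x]
      linear_combination h
    rw [h2]
  exact mul_left_cancel₀ Polynomial.X_ne_zero key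

lemma IsHalfTrigPoly.isTrigPoly_of_even {m : ℕ} {f : ℂ → ℂ} (hf : IsHalfTrigPoly (2 * m) f)
    (hper : ∀ lam, f (lam + (Real.pi : ℂ) * I) = (-1) ^ m * f lam) : IsTrigPoly m f := by
  obtain ⟨p, hp, hfp⟩ := hf
  obtain ⟨r, rfl⟩ := exists_expand_two_of_comp_neg_X
    (by simpa using comp_neg_X_eq (κ := 1) hfp (by simpa using hper))
  refine ⟨r, ?_, fun lam => ?_⟩
  · rw [Polynomial.natDegree_expand] at hp; omega
  · rw [hfp, Polynomial.expand_eval, ← exp_nat_mul]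
    congr 2
    push_cast; ring

lemma IsHalfTrigPoly.isTrigPoly_of_odd {k : ℕ} {f : ℂ → ℂ}
    (hf : IsHalfTrigPoly (2 * (k + 1)) f)
    (hper : ∀ lam, f (lam + (Real.pi : ℂ) * I) = -(-1) ^ (k + 1) * f lam) : IsTrigPoly k f := by
  obtain ⟨p, hp, hfp⟩ := hf
  have hodd : p.comp (-Polynomial.X) = -p := by
    simpa using comp_neg_X_eq (κ := -1) hfp (by simpa using hper)
  have h0 : p.coeff 0 = 0 := by
    have h1 := congrArg (fun q => Polynomial.coeff q 0) hodd
    simp only [coeff_comp_neg_X, Polynomial.coeff_neg, pow_zero, one_mul] at h1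
    linear_combination (1 / 2 : ℂ) * h1
  have hX : p = Polynomial.X * p.divX := by
    conv_lhs => rw [← Polynomial.X_mul_divX_add p, h0]
    simp
  have heven : p.divX.comp (-Polynomial.X) = p.divX := by
    have h2 := hodd
    rw [hX, Polynomial.mul_comp, Polynomial.X_comp] at h2
    refine mul_left_cancel₀ Polynomial.X_ne_zero ?_
    linear_combination -h2
  obtain ⟨r, hr⟩ := exists_expand_two_of_comp_neg_X heven
  have hdeg : p.divX.natDegree = p.natDegree - 1 := Polynomial.natDegree_divX_eq_natDegree_tsub_one
  rw [hr, Polynomial.natDegree_expand] at hdeg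
  refine ⟨r, by omega, fun lam => ?_⟩
  rw [hfp, hX, hr, Polynomial.eval_mul, Polynomial.eval_X, Polynomial.expand_eval, ← exp_nat_mul,
    ← mul_assoc, ← exp_add]
  congr 2
  push_cast; ring

lemma IsTrigPoly.exists_eq_prod_sinh_mul {ι : Type*} (S : Finset ι) (z : ι → ℂ)
    (hz : Set.InjOn (fun i => exp (2 * z i)) S) {k : ℕ} {f : ℂ → ℂ}
    (hf : IsTrigPoly (k + #S) f) (h0 : ∀ i ∈ S, f (z i) = 0) :
    ∃ g, IsTrigPoly k g ∧ ∀ lam, f lam = (∏ i ∈ S, sinh (lam - z i)) * g lam := by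
  obtain ⟨p, hp, hfp⟩ := hf
  have hdvd : ∏ i ∈ S, (Polynomial.X - Polynomial.C (exp (2 * z i))) ∣ p := by
    refine Finset.prod_dvd_of_coprime (fun i hi j hj hij => ?_) fun i hi => ?_
    · exact Polynomial.isCoprime_X_sub_C_of_isUnit_sub
        (sub_ne_zero.2 fun h => hij (hz hi hj h)).isUnit
    · rw [Polynomial.dvd_iff_isRoot, Polynomial.IsRoot]
      have := h0 i hi
      rw [hfp] at this
      exact (mul_eq_zero.1 this).resolve_left (exp_ne_zero _)
  obtain ⟨g, hg⟩ := hdvd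
  refine ⟨fun lam => exp (-(k : ℂ) * lam)
    * (Polynomial.C (∏ i ∈ S, (2 * exp (z i))) * g).eval (exp (2 * lam)),
    ⟨_, ?_, fun lam => rfl⟩, fun lam => ?_⟩
  · refine (Polynomial.natDegree_C_mul_le _ _).trans ?_
    by_cases hg0 : g = 0
    · simp [hg0]
    have hmonic : (∏ i ∈ S, (Polynomial.X - Polynomial.C (exp (2 * z i)))).Monic :=
      Polynomial.monic_prod_of_monic _ _ fun i _ => Polynomial.monic_X_sub_C _
    rw [hg, hmonic.natDegree_mul' hg0, Polynomial.natDegree_prod_of_monic _ _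
      fun i _ => Polynomial.monic_X_sub_C _] at hp
    simp only [Polynomial.natDegree_X_sub_C, Finset.sum_const, smul_eq_mul, mul_one] at hp
    omega
  · have hexp : exp (-((k + #S : ℕ) : ℂ) * lam)
        = exp (-(k : ℂ) * lam) * ∏ _i ∈ S, exp (-lam) := by
      rw [Finset.prod_const, ← exp_nat_mul, ← exp_add]; congr 1; push_cast; ring
    have hprod : (∏ i ∈ S, sinh (lam - z i)) * ∏ i ∈ S, (2 * exp (z i))
        = (∏ _i ∈ S, exp (-lam)) * ∏ i ∈ S, (exp (2 * lam) - exp (2 * z i)) := by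
      rw [← Finset.prod_mul_distrib, ← Finset.prod_mul_distrib]
      refine Finset.prod_congr rfl fun i _ => ?_
      have h1 : exp (lam - z i) * exp (z i) = exp (-lam) * exp (2 * lam) := by
        rw [← exp_add, ← exp_add]; congr 1; ring
      have h2 : exp (-(lam - z i)) * exp (z i) = exp (-lam) * exp (2 * z i) := by
        rw [← exp_add, ← exp_add]; congr 1; ring
      rw [Complex.sinh]
      linear_combination h1 - h2
    rw [hfp, hg, hexp]
    simp only [Polynomial.eval_mul, Polynomial.eval_C, Polynomial.eval_prod, Polynomial.eval_sub,
      Polynomial.eval_X]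
    linear_combination (-exp (-(k : ℂ) * lam) * g.eval (exp (2 * lam))) * hprod

lemma IsTrigPoly.eq_const {f : ℂ → ℂ} (hf : IsTrigPoly 0 f) : ∃ c, ∀ lam, f lam = c := by
  obtain ⟨p, hp, hfp⟩ := hf
  obtain ⟨c, rfl⟩ := Polynomial.natDegree_eq_zero.1 (Nat.le_zero.1 hp)
  exact ⟨c, fun lam => by simp [hfp]⟩

lemma IsTrigPoly.tForm {N : ℕ} (hN : 1 ≤ N) {f : ℂ → ℂ} (hf : IsTrigPoly (N - 1) f) :
    tForm N f := by
  obtain ⟨p, hp, hfp⟩ := hf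
  refine ⟨fun j => p.coeff j, fun lam => ?_⟩
  rw [hfp, Polynomial.eval_eq_sum_range' (n := N) (by omega),
    Fin.sum_univ_eq_sum_range (fun j => p.coeff j * exp (2 * (j : ℂ) * lam)), Nat.cast_sub hN,
    Nat.cast_one]
  congr 1
  refine Finset.sum_congr rfl fun j _ => ?_
  rw [← exp_nat_mul]
  congr 2
  ring

lemma tForm.const_mul {N : ℕ} {t : ℂ → ℂ} (ht : tForm N t) (a : ℂ) :
    tForm N (fun lam => a * t lam) := by
  obtain ⟨c, hc⟩ := ht
  refine ⟨fun j => a * c j, fun lam => ?_⟩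
  simp only [hc, mul_assoc, ← Finset.mul_sum]
  ring

lemma tForm.continuous {N : ℕ} {t : ℂ → ℂ} (ht : tForm N t) : Continuous t := by
  obtain ⟨c, hc⟩ := ht
  rw [funext hc]
  fun_prop

lemma tendsto_exp_neg_mul_sinh_add (c : ℂ) :
    Filter.Tendsto (fun r : ℝ => exp (-(r : ℂ)) * sinh ((r : ℂ) + c)) Filter.atTop
      (nhds (exp c / 2)) := by
  have h : (fun r : ℝ => exp (-(r : ℂ)) * sinh ((r : ℂ) + c))
      = fun r : ℝ => (exp c - ((Real.exp (-r) : ℝ) : ℂ) * ((Real.exp (-r) : ℝ) : ℂ) * exp (-c))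
        / 2 := by
    funext r
    have h1 : exp (-(r : ℂ)) * exp ((r : ℂ) + c) = exp c := by
      rw [← exp_add]; congr 1; ring
    have h2 : exp (-((r : ℂ) + c)) = exp (-(r : ℂ)) * exp (-c) := by
      rw [← exp_add]; congr 1; ring
    push_cast
    rw [Complex.sinh, h2]
    linear_combination h1 / 2
  have h0 : Filter.Tendsto (fun r : ℝ => ((Real.exp (-r) : ℝ) : ℂ)) Filter.atTop (nhds 0) := by
    have := (continuous_ofReal.tendsto 0).comp Real.tendsto_exp_neg_atTop_nhds_zero
    simpa [Function.comp_def] using this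
  rw [h]
  simpa using (((h0.mul h0).mul_const (exp (-c))).const_sub (exp c)).div_const 2

lemma tendsto_exp_neg_mul_sinh_neg_add (c : ℂ) :
    Filter.Tendsto (fun r : ℝ => exp (-(r : ℂ)) * sinh (-(r : ℂ) + c)) Filter.atTop
      (nhds (-(exp (-c) / 2))) := by
  refine (tendsto_exp_neg_mul_sinh_add (-c)).neg.congr fun r => ?_
  rw [show -(r : ℂ) + c = -((r : ℂ) + -c) by ring, sinh_neg]
  ring

lemma prod_exp_mul_prod_neg_exp_neg {ι : Type*} (S : Finset ι) (f : ι → ℂ) :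
    (∏ j ∈ S, (exp (f j) / 2)) * ∏ j ∈ S, (-(exp (-f j) / 2)) = (-1 / 4) ^ #S := by
  rw [← Finset.prod_mul_distrib, ← Finset.prod_const]
  refine Finset.prod_congr rfl fun j _ => ?_
  rw [mul_neg, div_mul_div_comm, ← exp_add]
  norm_num

lemma sq_eq_of_wronskian_eq_prod_sinh {m : ℕ} (μ : Fin m → ℂ) {η c : ℂ} {ι : Type*}
    (S : Finset ι) (hS : #S = m) (z : ι → ℂ)
    (h : ∀ lam : ℂ, (∏ j, sinh ((lam - μ j) / 2))
        * (∏ j, sinh ((lam + (Real.pi : ℂ) * I - η - μ j) / 2))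
      + (∏ j, sinh ((lam + (Real.pi : ℂ) * I - μ j) / 2)) * (∏ j, sinh ((lam - η - μ j) / 2))
      = (∏ i ∈ S, sinh (lam - z i)) * c) :
    c ^ 2 = 4 * (-1 / 4) ^ m := by
  have two : Filter.Tendsto (fun r : ℝ => 2 * r) Filter.atTop Filter.atTop :=
    Filter.tendsto_id.const_mul_atTop two_pos
  have pos (b : ℂ) : Filter.Tendsto (fun r : ℝ => ∏ j, (exp (-(r : ℂ)) * sinh (r + (b - μ j) / 2)))
      Filter.atTop (nhds (∏ j, (exp ((b - μ j) / 2) / 2))) :=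
    tendsto_finsetProd _ fun j _ => tendsto_exp_neg_mul_sinh_add _
  have neg (b : ℂ) :
      Filter.Tendsto (fun r : ℝ => ∏ j, (exp (-(r : ℂ)) * sinh (-r + (b - μ j) / 2)))
        Filter.atTop (nhds (∏ j, (-(exp (-((b - μ j) / 2)) / 2)))) :=
    tendsto_finsetProd _ fun j _ => tendsto_exp_neg_mul_sinh_neg_add _
  have posR : Filter.Tendsto
      (fun r : ℝ => (∏ i ∈ S, (exp (-((2 * r : ℝ) : ℂ)) * sinh ((2 * r : ℝ) + -z i))) * c)
      Filter.atTop (nhds ((∏ i ∈ S, (exp (-z i) / 2)) * c)) :=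
    (tendsto_finsetProd _ fun i _ => (tendsto_exp_neg_mul_sinh_add (-z i)).comp two).mul_const c
  have negR : Filter.Tendsto
      (fun r : ℝ => (∏ i ∈ S, (exp (-((2 * r : ℝ) : ℂ)) * sinh (-(2 * r : ℝ) + -z i))) * c)
      Filter.atTop (nhds ((∏ i ∈ S, (-(exp (-(-z i)) / 2))) * c)) :=
    (tendsto_finsetProd _ fun i _ =>
      (tendsto_exp_neg_mul_sinh_neg_add (-z i)).comp two).mul_const c
  have hexp (r : ℝ) : exp (-((2 * r : ℝ) : ℂ)) = exp (-(r : ℂ)) * exp (-(r : ℂ)) := by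
    rw [← exp_add]; congr 1; push_cast; ring
  have hpos := tendsto_nhds_unique
    ((((pos 0).mul (pos ((Real.pi : ℂ) * I - η))).add
      ((pos ((Real.pi : ℂ) * I)).mul (pos (-η)))).congr fun r => by
        have h2 := h (2 * r)
        simp only [Finset.prod_mul_distrib, Finset.prod_const, hS, hexp, Finset.card_univ,
          Fintype.card_fin]
        push_cast
        simp only [← sub_eq_add_neg (2 * (r : ℂ))]
        rw [mul_assoc _ _ c, ← h2]
        have e1 (j) : (2 * (r : ℂ) - μ j) / 2 = r + (0 - μ j) / 2 := by ring
        have e2 (j) : (2 * (r : ℂ) + (Real.pi : ℂ) * I - η - μ j) / 2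
          = r + ((Real.pi : ℂ) * I - η - μ j) / 2 := by ring
        have e3 (j) : (2 * (r : ℂ) + (Real.pi : ℂ) * I - μ j) / 2
          = r + ((Real.pi : ℂ) * I - μ j) / 2 := by ring
        have e4 (j) : (2 * (r : ℂ) - η - μ j) / 2 = r + (-η - μ j) / 2 := by ring
        simp only [e1, e2, e3, e4]
        ring) posR
  have hneg := tendsto_nhds_unique
    ((((neg 0).mul (neg ((Real.pi : ℂ) * I - η))).add
      ((neg ((Real.pi : ℂ) * I)).mul (neg (-η)))).congr fun r => by
        have h2 := h (-(2 * r))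
        simp only [Finset.prod_mul_distrib, Finset.prod_const, hS, hexp, Finset.card_univ,
          Fintype.card_fin]
        push_cast
        simp only [← sub_eq_add_neg (-(2 * (r : ℂ)))]
        rw [mul_assoc _ _ c, ← h2]
        have e1 (j) : (-(2 * (r : ℂ)) - μ j) / 2 = -r + (0 - μ j) / 2 := by ring
        have e2 (j) : (-(2 * (r : ℂ)) + (Real.pi : ℂ) * I - η - μ j) / 2
          = -r + ((Real.pi : ℂ) * I - η - μ j) / 2 := by ring
        have e3 (j) : (-(2 * (r : ℂ)) + (Real.pi : ℂ) * I - μ j) / 2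
          = -r + ((Real.pi : ℂ) * I - μ j) / 2 := by ring
        have e4 (j) : (-(2 * (r : ℂ)) - η - μ j) / 2 = -r + (-η - μ j) / 2 := by ring
        simp only [e1, e2, e3, e4]
        ring) negR
  have epos : (∏ j, (exp (((Real.pi : ℂ) * I - μ j) / 2) / 2)) * ∏ j, (exp ((-η - μ j) / 2) / 2)
      = (∏ j, (exp ((0 - μ j) / 2) / 2)) * ∏ j, (exp (((Real.pi : ℂ) * I - η - μ j) / 2) / 2) := by
    rw [← Finset.prod_mul_distrib, ← Finset.prod_mul_distrib]
    refine Finset.prod_congr rfl fun j _ => ?_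
    rw [div_mul_div_comm, div_mul_div_comm, ← exp_add, ← exp_add]
    congr 2; ring
  have eneg : (∏ j, (-(exp (-(((Real.pi : ℂ) * I - μ j) / 2)) / 2)))
        * ∏ j, (-(exp (-((-η - μ j) / 2)) / 2))
      = (∏ j, (-(exp (-((0 - μ j) / 2)) / 2)))
        * ∏ j, (-(exp (-(((Real.pi : ℂ) * I - η - μ j) / 2)) / 2)) := by
    rw [← Finset.prod_mul_distrib, ← Finset.prod_mul_distrib]
    refine Finset.prod_congr rfl fun j _ => ?_
    rw [neg_mul_neg, neg_mul_neg, div_mul_div_comm, div_mul_div_comm, ← exp_add, ← exp_add]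
    congr 2; ring
  have pS := prod_exp_mul_prod_neg_exp_neg S fun i => -z i
  have p0 := prod_exp_mul_prod_neg_exp_neg Finset.univ fun j : Fin m => (0 - μ j) / 2
  have p1 := prod_exp_mul_prod_neg_exp_neg Finset.univ
    fun j : Fin m => ((Real.pi : ℂ) * I - η - μ j) / 2
  rw [epos] at hpos
  rw [eneg] at hneg
  rw [hS] at pS
  simp only [Finset.card_univ, Fintype.card_fin] at p0 p1
  have hne : ((-1 / 4 : ℂ)) ^ m ≠ 0 := pow_ne_zero _ (by norm_num)
  apply mul_left_cancel₀ hne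
  have hmul := congrArg₂ (· * ·) hpos hneg
  generalize (∏ j, (exp ((0 - μ j) / 2) / 2)) = A at *
  generalize (∏ j, (exp (((Real.pi : ℂ) * I - η - μ j) / 2) / 2)) = B at *
  generalize (∏ j, (-(exp (-((0 - μ j) / 2)) / 2))) = A' at *
  generalize (∏ j, (-(exp (-(((Real.pi : ℂ) * I - η - μ j) / 2)) / 2))) = B' at *
  generalize (∏ j ∈ S, (exp (-z j) / 2)) = Z at *
  generalize (∏ j ∈ S, (-(exp (-(-z j)) / 2))) = Z' at *
  generalize ((-1 / 4 : ℂ)) ^ m = q at *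
  linear_combination (-c ^ 2) * pS - hmul + 4 * B * B' * p0 + 4 * q * p1

lemma xik_succ {N : ℕ} (η : ℂ) (σ : Fin N → ℕ) (ξ : Fin N → ℂ) (n : Fin N) (k : ℕ) :
    xik η σ ξ n (k + 1) = xik η σ ξ n k - η := by
  simp only [xik]
  push_cast
  ring

lemma injOn_exp_two_mul_xik {N : ℕ} {η : ℂ} {σ : Fin N → ℕ} {ξ : Fin N → ℂ}
    (hη : ∀ r : ℚ, η ≠ (r : ℂ) * ((Real.pi : ℂ) * I)) (hC : CondC η σ ξ) :
    Set.InjOn (fun x : Σ _ : Fin N, ℕ => exp (2 * xik η σ ξ x.1 x.2)) {x | x.2 ≤ σ x.1} := by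
  rintro ⟨n, h⟩ hh ⟨n', h'⟩ hh' heq
  simp only [Set.mem_ofPred_eq] at hh hh' heq
  obtain ⟨k, hk⟩ := exp_eq_exp_iff_exists_int.1 heq
  have hx : xik η σ ξ n h = xik η σ ξ n' h' + (k : ℂ) * ((Real.pi : ℂ) * I) := by
    linear_combination hk / 2
  obtain rfl : n = n' := by
    by_contra hne
    have hmem : xik η σ ξ n h ∈ XiSet η σ ξ n ∩ XiSet η σ ξ n' :=
      ⟨⟨h, hh, 0, by simp⟩, ⟨h', hh', k, hx⟩⟩
    simp [hC n n' hne] at hmem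
  obtain rfl : h = h' := by
    by_contra hne
    have hsub : (h' : ℂ) - h ≠ 0 := sub_ne_zero.2 fun e => hne (Nat.cast_injective e).symm
    refine hη ((k : ℚ) / ((h' : ℚ) - h)) ?_
    push_cast
    rw [div_mul_eq_mul_div, eq_div_iff hsub]
    simp only [xik] at hx
    linear_combination hx
  rfl

lemma dfun_eq {N : ℕ} (η : ℂ) (σ : Fin N → ℕ) (ξ : Fin N → ℂ) (lam : ℂ) :
    dfun η σ ξ lam = ∏ n, sinh (lam - xik η σ ξ n 0) := by
  refine Finset.prod_congr rfl fun n _ => ?_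
  congr 1
  simp only [xik]
  push_cast
  ring

lemma afun_eq {N : ℕ} (η : ℂ) (σ : Fin N → ℕ) (ξ : Fin N → ℂ) (lam : ℂ) :
    afun η σ ξ lam = ∏ n, sinh (lam - xik η σ ξ n (σ n)) := by
  refine Finset.prod_congr rfl fun n _ => ?_
  congr 1
  simp only [xik]
  ring

lemma dfun_mul_wfun {N : ℕ} {η : ℂ} {σ : Fin N → ℕ} (hσ : ∀ n, 1 ≤ σ n) {ξ : Fin N → ℂ}
    (ε lam : ℂ) : dfun η σ ξ lam * wfun η σ ξ ε lam = 2 * ε * (I / 2) ^ (∑ n, σ n)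
      * ∏ n, ∏ h ∈ Finset.range (σ n), sinh (lam - xik η σ ξ n h) := by
  have : ∏ n, ∏ h ∈ Finset.range (σ n), sinh (lam - xik η σ ξ n h)
      = dfun η σ ξ lam * ∏ n, ∏ h ∈ Finset.Icc 1 (σ n - 1), sinh (lam - xik η σ ξ n h) := by
    rw [dfun_eq, ← Finset.prod_mul_distrib]
    refine Finset.prod_congr rfl fun n _ => ?_
    have hI : Finset.Icc 1 (σ n - 1) = Finset.Ico 1 (σ n) := by ext; simp; have := hσ n; omega
    rw [hI, Finset.range_eq_Ico, Finset.prod_eq_prod_Ico_succ_bot (by have := hσ n; omega)]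
  rw [this, wfun]
  ring

lemma afun_mul_wfun {N : ℕ} {η : ℂ} {σ : Fin N → ℕ} (hσ : ∀ n, 1 ≤ σ n) {ξ : Fin N → ℂ}
    (ε lam : ℂ) : afun η σ ξ lam * wfun η σ ξ ε lam
      = dfun η σ ξ (lam + η) * wfun η σ ξ ε (lam + η) := by
  have : ∏ n, ∏ h ∈ Finset.range (σ n), sinh (lam + η - xik η σ ξ n h)
      = afun η σ ξ lam * ∏ n, ∏ h ∈ Finset.Icc 1 (σ n - 1), sinh (lam - xik η σ ξ n h) := by
    rw [afun_eq, ← Finset.prod_mul_distrib]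
    refine Finset.prod_congr rfl fun n _ => ?_
    have hI : Finset.Icc 1 (σ n - 1) = Finset.Ico 1 (σ n) := by ext; simp; have := hσ n; omega
    rw [hI, mul_comm, ← Finset.prod_Ico_succ_top (hσ n), Finset.range_eq_Ico,
      ← Finset.prod_Ico_add' _ 0 (σ n) 1]
    refine Finset.prod_congr rfl fun h _ => ?_
    rw [xik_succ]
    congr 1; ring
  rw [dfun_mul_wfun hσ, this, wfun]
  ring

lemma dense_wfun_ne_zero {N : ℕ} (η : ℂ) (σ : Fin N → ℕ) (ξ : Fin N → ℂ) {ε : ℂ} (hε : ε ≠ 0) :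
    Dense {lam | wfun η σ ξ ε lam ≠ 0} := by
  have hcount : (⋃ x : (Fin N × ℕ) × ℤ,
      {xik η σ ξ x.1.1 x.1.2 + (x.2 : ℂ) * ((Real.pi : ℂ) * I)}).Countable :=
    Set.countable_iUnion fun _ => Set.countable_singleton _
  refine (hcount.dense_compl ℂ).mono fun lam hlam => ?_
  rw [Set.mem_compl_iff] at hlam
  refine fun h0 => hlam ?_
  simp only [wfun, mul_eq_zero, pow_eq_zero_iff', div_eq_zero_iff, I_ne_zero, two_ne_zero, hε,
    or_self, false_and, false_or, Finset.prod_eq_zero_iff] at h0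
  obtain ⟨n, -, h, -, h0⟩ := h0
  have h1 : exp (lam - xik η σ ξ n h) = exp (-(lam - xik η σ ξ n h)) := by
    rw [Complex.sinh] at h0
    linear_combination 2 * h0
  obtain ⟨k, hk⟩ := exp_eq_exp_iff_exists_int.1 h1
  refine Set.mem_iUnion.2 ⟨((n, h), k), ?_⟩
  rw [Set.mem_singleton_iff]
  linear_combination hk / 2

lemma sum_tridiagonal_mul (m h : ℕ) (hh : h ≤ m) (A B C : ℂ) (v : ℕ → ℂ)
    (hB : h = m → B = 0) (hC : h = 0 → C = 0) :
    ∑ k ∈ Finset.range (m + 1),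
      (if h = k then A else if k = h + 1 then B else if h = k + 1 then C else 0) * v k
      = A * v h + B * v (h + 1) + C * v (h - 1) := by
  have hterm (k : ℕ) :
      (if h = k then A else if k = h + 1 then B else if h = k + 1 then C else 0) * v k
      = (if h = k then A * v k else 0) + (if h + 1 = k then B * v k else 0)
        + (if h - 1 = k then C * v k else 0) := by
    rcases Nat.eq_zero_or_pos h with rfl | hpos
    · rw [hC rfl]
      split_ifs <;> first | omega | simp
    · split_ifs <;> first | omega | simp
  simp only [hterm, Finset.sum_add_distrib, Finset.sum_ite_eq, Finset.mem_range]
  rw [if_pos (by omega : h < m + 1), if_pos (by omega : h - 1 < m + 1)]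
  split_ifs with h1
  · rfl
  · rw [hB (by omega)]; simp

lemma det_Dmat_eq_zero {N : ℕ} {η : ℂ} {σ : Fin N → ℕ} {ξ : Fin N → ℂ} {t f : ℂ → ℂ} {κ : ℂ}
    (hκ : κ * κ = 1)
    (hf : ∀ lam, t lam * f lam
      = κ * (dfun η σ ξ lam * f (lam + η) - afun η σ ξ lam * f (lam - η)))
    (n : Fin N) (hne : ∃ h : Fin (σ n + 1), f (xik η σ ξ n h) ≠ 0) :
    (Dmat η σ ξ t n).det = 0 := by
  have hκ0 : κ ≠ 0 := left_ne_zero_of_mul_eq_one hκ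
  obtain ⟨h₀, hh₀⟩ := hne
  refine Matrix.exists_mulVec_eq_zero_iff.1
    ⟨fun h : Fin (σ n + 1) => κ ^ (h : ℕ) * f (xik η σ ξ n h), fun h0 => ?_, ?_⟩
  · exact mul_ne_zero (pow_ne_zero _ hκ0) hh₀ (congrFun h0 h₀)
  ext h
  have hd : (h : ℕ) = 0 → -dfun η σ ξ (xik η σ ξ n h) = 0 := fun e => by
    rw [e, dfun_eq, neg_eq_zero]
    exact Finset.prod_eq_zero (Finset.mem_univ n) (by simp)
  have ha : (h : ℕ) = σ n → afun η σ ξ (xik η σ ξ n h) = 0 := fun e => by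
    rw [e, afun_eq]
    exact Finset.prod_eq_zero (Finset.mem_univ n) (by simp)
  have hsum := sum_tridiagonal_mul (σ n) h (by omega) (t (xik η σ ξ n h))
    (afun η σ ξ (xik η σ ξ n h)) (-dfun η σ ξ (xik η σ ξ n h))
    (fun k => κ ^ k * f (xik η σ ξ n k)) ha hd
  rw [← Fin.sum_univ_eq_sum_range (fun k : ℕ => (if (h : ℕ) = k then t (xik η σ ξ n h) else
    if k = h + 1 then afun η σ ξ (xik η σ ξ n h) else
    if (h : ℕ) = k + 1 then -dfun η σ ξ (xik η σ ξ n h) else 0) * (κ ^ k * f (xik η σ ξ n k)))]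
    at hsum
  simp only [Matrix.mulVec, dotProduct, Dmat, Matrix.of_apply, Pi.zero_apply]
  rw [hsum, xik_succ]
  have hf' := hf (xik η σ ξ n h)
  rcases Nat.eq_zero_or_pos (h : ℕ) with e | hpos
  · have hd' := hd e
    rw [e] at hf' hd' ⊢
    simp only [zero_add, pow_zero, pow_one]
    linear_combination hf' + (f (xik η σ ξ n (0 - 1)) - κ * f (xik η σ ξ n 0 + η)) * hd'
  · obtain ⟨k, hk⟩ := Nat.exists_eq_add_of_le' hpos
    rw [hk] at hf' ⊢
    have hx : xik η σ ξ n (k + 1) + η = xik η σ ξ n k := by rw [xik_succ]; ring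
    rw [hx] at hf'
    simp only [Nat.add_sub_cancel]
    linear_combination κ ^ (k + 1) * hf' + κ ^ k * dfun η σ ξ (xik η σ ξ n (k + 1))
      * f (xik η σ ξ n k) * hκ

lemma mul_eq_mul_of_linear_dependent {ι : Type*} {u v : ι → ℂ} {c₁ c₂ : ℂ}
    (hc : ¬(c₁ = 0 ∧ c₂ = 0)) (h : ∀ i, c₁ * u i + c₂ * v i = 0) (i j : ι) :
    u i * v j = u j * v i := by
  by_cases h1 : c₁ = 0
  · have h2 : c₂ ≠ 0 := fun e => hc ⟨h1, e⟩
    apply mul_left_cancel₀ h2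
    linear_combination u i * h j - u j * h i
  · apply mul_left_cancel₀ h1
    linear_combination v j * h i - v i * h j

lemma prod_sinh_half_add_two_pi_mul_I {m : ℕ} (μ : Fin m → ℂ) (lam : ℂ) :
    ∏ j, sinh ((lam + (Real.pi : ℂ) * I + (Real.pi : ℂ) * I - μ j) / 2)
      = (-1) ^ m * ∏ j, sinh ((lam - μ j) / 2) := by
  have h (j : Fin m) : sinh ((lam + (Real.pi : ℂ) * I + (Real.pi : ℂ) * I - μ j) / 2)
      = -1 * sinh ((lam - μ j) / 2) := by
    rw [show (lam + (Real.pi : ℂ) * I + (Real.pi : ℂ) * I - μ j) / 2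
      = (lam - μ j) / 2 + (Real.pi : ℂ) * I by ring, sinh_add_pi_mul_I, neg_one_mul]
  simp only [h, Finset.prod_mul_distrib, Finset.prod_const, Finset.card_univ, Fintype.card_fin]

theorem stmt_12 {N : ℕ} (hN : 1 ≤ N) (σ : Fin N → ℕ) (hσ : ∀ n, 1 ≤ σ n)
    (η : ℂ) (hη : ∀ r : ℚ, η ≠ (r : ℂ) * ((Real.pi : ℂ) * Complex.I))
    (ξ : Fin N → ℂ) (hC : CondC η σ ξ)
    (Q : ℂ → ℂ) (μ : Fin (∑ n, σ n) → ℂ)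
    (hQ : ∀ lam : ℂ, Q lam = ∏ j, Complex.sinh ((lam - μ j) / 2))
    (hdep : ∀ n : Fin N,
      (∃ c₁ c₂ : ℂ, ¬(c₁ = 0 ∧ c₂ = 0) ∧ ∀ h : Fin (σ n + 1),
        c₁ * Q (xik η σ ξ n (h : ℕ))
          + c₂ * ((-1 : ℂ) ^ (h : ℕ) * Q (xik η σ ξ n (h : ℕ) + (Real.pi : ℂ) * Complex.I)) = 0) ∧
      ¬((∀ h : Fin (σ n + 1), Q (xik η σ ξ n (h : ℕ)) = 0) ∧
        (∀ h : Fin (σ n + 1),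
          (-1 : ℂ) ^ (h : ℕ) * Q (xik η σ ξ n (h : ℕ) + (Real.pi : ℂ) * Complex.I) = 0))) :
    ∃ ε : ℂ, (ε = 1 ∨ ε = -1) ∧
      (∀ lam : ℂ,
        Q lam * Q (lam + (Real.pi : ℂ) * Complex.I - η)
          + Q (lam + (Real.pi : ℂ) * Complex.I) * Q (lam - η)
        = dfun η σ ξ lam * wfun η σ ξ ε lam) ∧
      ∃ t : ℂ → ℂ, tForm N t ∧
        (∀ lam : ℂ, t lam * wfun η σ ξ ε lam =
          Q (lam + η) * Q (lam + (Real.pi : ℂ) * Complex.I - η)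
            - Q (lam + η + (Real.pi : ℂ) * Complex.I) * Q (lam - η)) ∧
        ∀ n : Fin N, (Dmat η σ ξ t n).det = 0 := by
  have hdep' (n : Fin N) (h k : ℕ) (hh : h ≤ σ n) (hk : k ≤ σ n) :
      Q (xik η σ ξ n h) * ((-1) ^ k * Q (xik η σ ξ n k + (Real.pi : ℂ) * I))
        = Q (xik η σ ξ n k) * ((-1) ^ h * Q (xik η σ ξ n h + (Real.pi : ℂ) * I)) := by
    obtain ⟨⟨c₁, c₂, hc, hlin⟩, -⟩ := hdep n
    exact mul_eq_mul_of_linear_dependent hc hlin ⟨h, by omega⟩ ⟨k, by omega⟩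
  have hper (lam : ℂ) : Q (lam + (Real.pi : ℂ) * I + (Real.pi : ℂ) * I)
      = (-1) ^ (∑ n, σ n) * Q lam := by
    rw [hQ, hQ, prod_sinh_half_add_two_pi_mul_I]
  have hhalf (c : ℂ) : IsHalfTrigPoly (∑ n, σ n) (fun lam => Q (lam + c)) := by
    simpa only [hQ] using isHalfTrigPoly_prod_sinh μ c
  have hcont : Continuous Q := by
    rw [funext hQ]
    fun_prop
  have hinj := injOn_exp_two_mul_xik hη hC
  have hsumle : N ≤ ∑ n, σ n := by
    simpa using Finset.sum_le_sum fun n (_ : n ∈ Finset.univ) => hσ n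
  -- the Wronskian relation
  obtain ⟨ε, hε, hW⟩ : ∃ ε : ℂ, (ε = 1 ∨ ε = -1) ∧ ∀ lam : ℂ,
      Q lam * Q (lam + (Real.pi : ℂ) * I - η) + Q (lam + (Real.pi : ℂ) * I) * Q (lam - η)
        = dfun η σ ξ lam * wfun η σ ξ ε lam := by
    set S : Finset (Σ _ : Fin N, ℕ) := Finset.univ.sigma fun n => Finset.range (σ n) with hS
    have hcard : #S = ∑ n, σ n := by simp [hS]
    have htrig : IsTrigPoly (0 + #S) fun lam =>
        Q lam * Q (lam + (Real.pi : ℂ) * I - η)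
          + Q (lam + (Real.pi : ℂ) * I) * Q (lam - η) := by
      rw [hcard, zero_add]
      refine IsHalfTrigPoly.isTrigPoly_of_even ?_ fun lam => ?_
      · rw [two_mul]
        simpa only [add_zero, ← add_sub_assoc, ← sub_eq_add_neg] using
          ((hhalf 0).mul (hhalf ((Real.pi : ℂ) * I - η))).add
            ((hhalf ((Real.pi : ℂ) * I)).mul (hhalf (-η)))
      · have h1 := hper (lam - η)
        rw [show lam - η + (Real.pi : ℂ) * I + (Real.pi : ℂ) * I
          = lam + (Real.pi : ℂ) * I + (Real.pi : ℂ) * I - η by ring] at h1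
        rw [h1, hper]
        ring
    obtain ⟨g, hg, hfac⟩ := htrig.exists_eq_prod_sinh_mul S (fun x => xik η σ ξ x.1 x.2)
      (hinj.mono fun x hx => by
        have : x.2 < σ x.1 := by simpa [hS] using hx
        exact this.le)
      fun x hx => by
        have hx : x.2 < σ x.1 := by simpa [hS] using hx
        have h1 := hdep' x.1 x.2 (x.2 + 1) (by omega) (by omega)
        rw [xik_succ, show xik η σ ξ x.1 x.2 - η + (Real.pi : ℂ) * I
          = xik η σ ξ x.1 x.2 + (Real.pi : ℂ) * I - η by ring, pow_succ] at h1
        apply mul_left_cancel₀ (pow_ne_zero x.2 (neg_ne_zero.2 one_ne_zero : (-1 : ℂ) ≠ 0))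
        linear_combination -h1
    obtain ⟨c, hc⟩ := hg.eq_const
    simp only [hc] at hfac
    have hsq := sq_eq_of_wronskian_eq_prod_sinh (η := η) μ S hcard _
      (fun lam => by simpa only [hQ] using hfac lam)
    have hI : (I / 2 : ℂ) ^ (∑ n, σ n) ≠ 0 := pow_ne_zero _ (div_ne_zero I_ne_zero two_ne_zero)
    have hI2 : ((I / 2 : ℂ) ^ (∑ n, σ n)) ^ 2 = (-1 / 4) ^ (∑ n, σ n) := by
      rw [← pow_mul, mul_comm, pow_mul, div_pow, I_sq]; norm_num
    refine ⟨c / (2 * (I / 2) ^ (∑ n, σ n)), ?_, fun lam => ?_⟩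
    · have hne : (-1 / 4 : ℂ) ^ (∑ n, σ n) ≠ 0 := pow_ne_zero _ (by norm_num)
      rw [← mul_self_eq_one_iff, ← pow_two, div_pow, mul_pow, hI2, hsq, div_eq_one_iff_eq]
      · norm_num
      · exact mul_ne_zero (by norm_num) hne
    · rw [dfun_mul_wfun hσ, hfac, hS, Finset.prod_sigma]
      field_simp
  have hε0 : ε ≠ 0 := by rcases hε with rfl | rfl <;> norm_num
  -- divisibility of the second bilinear combination
  obtain ⟨t, ht, htw⟩ : ∃ t : ℂ → ℂ, tForm N t ∧ ∀ lam : ℂ, t lam * wfun η σ ξ ε lam =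
      Q (lam + η) * Q (lam + (Real.pi : ℂ) * I - η)
        - Q (lam + η + (Real.pi : ℂ) * I) * Q (lam - η) := by
    set S : Finset (Σ _ : Fin N, ℕ) := Finset.univ.sigma fun n => Finset.Icc 1 (σ n - 1) with hS
    have hcard : #S + N = ∑ n, σ n := by
      have h1 : ∑ n, σ n = ∑ n, ((σ n - 1) + 1) :=
        Finset.sum_congr rfl fun n _ => (Nat.sub_add_cancel (hσ n)).symm
      rw [h1, Finset.sum_add_distrib]
      simp [hS]
    have htrig : IsTrigPoly (N - 1 + #S) fun lam =>
        Q (lam + η) * Q (lam + (Real.pi : ℂ) * I - η)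
          - Q (lam + η + (Real.pi : ℂ) * I) * Q (lam - η) := by
      have hm : N - 1 + #S + 1 = ∑ n, σ n := by omega
      refine IsHalfTrigPoly.isTrigPoly_of_odd ?_ fun lam => ?_
      · rw [hm, two_mul]
        simpa only [← add_assoc, ← add_sub_assoc, ← sub_eq_add_neg] using
          ((hhalf η).mul (hhalf ((Real.pi : ℂ) * I - η))).sub
            ((hhalf (η + (Real.pi : ℂ) * I)).mul (hhalf (-η)))
      · rw [hm, show lam + (Real.pi : ℂ) * I + (Real.pi : ℂ) * I - η
            = lam - η + (Real.pi : ℂ) * I + (Real.pi : ℂ) * I by ring,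
          show lam + (Real.pi : ℂ) * I + η + (Real.pi : ℂ) * I
            = lam + η + (Real.pi : ℂ) * I + (Real.pi : ℂ) * I by ring, hper, hper,
          show lam + (Real.pi : ℂ) * I + η = lam + η + (Real.pi : ℂ) * I by ring]
        ring
    obtain ⟨g, hg, hfac⟩ := htrig.exists_eq_prod_sinh_mul S (fun x => xik η σ ξ x.1 x.2)
      (hinj.mono fun x hx => by
        have : 1 ≤ x.2 ∧ x.2 ≤ σ x.1 - 1 := by simpa [hS] using hx
        exact this.2.trans (Nat.sub_le _ _))
      fun x hx => by
        obtain ⟨n, h⟩ := x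
        have hx : 1 ≤ h ∧ h ≤ σ n - 1 := by simpa [hS] using hx
        obtain ⟨k, rfl⟩ := Nat.exists_eq_add_of_le' hx.1
        have h1 := hdep' n k (k + 1 + 1) (by omega) (by omega)
        have hp : xik η σ ξ n (k + 1) + η = xik η σ ξ n k := by rw [xik_succ]; ring
        have hm : xik η σ ξ n (k + 1) - η = xik η σ ξ n (k + 1 + 1) := (xik_succ ..).symm
        simp only
        rw [show xik η σ ξ n (k + 1) + (Real.pi : ℂ) * I - η
          = xik η σ ξ n (k + 1) - η + (Real.pi : ℂ) * I by ring, hp, hm]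
        apply mul_left_cancel₀ (pow_ne_zero k (neg_ne_zero.2 one_ne_zero : (-1 : ℂ) ≠ 0))
        rw [pow_succ, pow_succ] at h1
        linear_combination h1
    have hI : (I / 2 : ℂ) ^ (∑ n, σ n) ≠ 0 := pow_ne_zero _ (div_ne_zero I_ne_zero two_ne_zero)
    refine ⟨_, (hg.tForm hN).const_mul (2 * ε * (I / 2) ^ (∑ n, σ n))⁻¹, fun lam => ?_⟩
    rw [hfac, wfun, hS, Finset.prod_sigma]
    field_simp
  refine ⟨ε, hε, hW, t, ht, htw, fun n => ?_⟩
  have haW (lam : ℂ) : Q (lam + η) * Q (lam + (Real.pi : ℂ) * I)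
      + Q (lam + η + (Real.pi : ℂ) * I) * Q lam = afun η σ ξ lam * wfun η σ ξ ε lam := by
    rw [afun_mul_wfun hσ, ← hW, add_sub_cancel_right, show lam + η + (Real.pi : ℂ) * I - η
      = lam + (Real.pi : ℂ) * I by ring]
  have hda : Continuous (dfun η σ ξ) ∧ Continuous (afun η σ ξ) := by
    unfold dfun afun
    constructor <;> fun_prop
  obtain ⟨hcd, hca⟩ := hda
  have hct := ht.continuous
  have hTQ (lam : ℂ) : t lam * Q lam
      = 1 * (dfun η σ ξ lam * Q (lam + η) - afun η σ ξ lam * Q (lam - η)) := by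
    refine congrFun (Continuous.ext_on (f := fun lam => t lam * Q lam)
      (g := fun lam => 1 * (dfun η σ ξ lam * Q (lam + η) - afun η σ ξ lam * Q (lam - η)))
      (dense_wfun_ne_zero η σ ξ hε0) (by fun_prop) (by fun_prop) fun lam hlam => ?_) lam
    simp only
    apply mul_right_cancel₀ (show wfun η σ ξ ε lam ≠ 0 from hlam)
    linear_combination Q lam * htw lam + Q (lam + η) * hW lam - Q (lam - η) * haW lam
  have hTP (lam : ℂ) : t lam * Q (lam + (Real.pi : ℂ) * I)
      = -1 * (dfun η σ ξ lam * Q (lam + η + (Real.pi : ℂ) * I)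
        - afun η σ ξ lam * Q (lam - η + (Real.pi : ℂ) * I)) := by
    refine congrFun (Continuous.ext_on (f := fun lam => t lam * Q (lam + (Real.pi : ℂ) * I))
      (g := fun lam => -1 * (dfun η σ ξ lam * Q (lam + η + (Real.pi : ℂ) * I)
        - afun η σ ξ lam * Q (lam - η + (Real.pi : ℂ) * I)))
      (dense_wfun_ne_zero η σ ξ hε0) (by fun_prop) (by fun_prop) fun lam hlam => ?_) lam
    simp only
    apply mul_right_cancel₀ (show wfun η σ ξ ε lam ≠ 0 from hlam)
    rw [show lam - η + (Real.pi : ℂ) * I = lam + (Real.pi : ℂ) * I - η by ring]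
    linear_combination Q (lam + (Real.pi : ℂ) * I) * htw lam
      - Q (lam + η + (Real.pi : ℂ) * I) * hW lam
      + Q (lam + (Real.pi : ℂ) * I - η) * haW lam
  by_cases hu : ∃ h : Fin (σ n + 1), Q (xik η σ ξ n h) ≠ 0
  · exact det_Dmat_eq_zero (by norm_num) hTQ n hu
  · push Not at hu
    refine det_Dmat_eq_zero (f := fun lam => Q (lam + (Real.pi : ℂ) * I)) (by norm_num) hTP n ?_
    by_contra! hv
    exact (hdep n).2 ⟨hu, fun h => by rw [hv h, mul_zero]⟩
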